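/- There is a universal constant C such that for every ε ∈ (0,1) and every n ≥ C·ε^{−2} the following holds. Let H = ∑_{u<v} H_{uv} be a 2-local Hamiltonian on n qubits with interaction-strength matrix J_{uv} = ‖H_{uv}‖_∞. Then there exist a width s ≤ C·ε^{−2}, sets R^{ijk}, L^{ijk} ⊆ {1,…,n} and reals d^{ijk} (i,j ∈ {0,1,2,3}, k ∈ {1,…,s}) with ∑_{k=1}^s (d^{ijk})² ≤ C·‖J‖_F²/n² for each pair (i,j), such that the cut-decomposed Hamiltonian H_D they define satisfies |Tr[Hρ] − Tr[H_D ρ]| ≤ ε·n·‖J‖_F for every product mixed state ρ = ⊗_{u=1}^n ρ_u. -/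

import Mathlib

open scoped BigOperators ComplexOrder

noncomputable section

namespace QLH

/-- The operator (spectral) norm of a square complex matrix. -/
def opNorm {m : Type*} [Fintype m] [DecidableEq m] (A : Matrix m m ℂ) : ℝ :=
  ‖Matrix.toEuclideanCLM (𝕜 := ℂ) A‖

/-- A density matrix: positive semidefinite with unit trace. -/
def IsDensity {m : Type*} [Fintype m] (ρ : Matrix m m ℂ) : Prop :=
  ρ.PosSemidef ∧ ρ.trace = 1

/-- The (real) energy `Tr[Hρ]`. -/
def energy {m : Type*} [Fintype m] (H ρ : Matrix m m ℂ) : ℝ :=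
  ((H * ρ).trace).re

/-- `A` acts (nontrivially) only on the sites in `e`. -/
def ActsOn {n : ℕ} {α : Type*} [Fintype α] [DecidableEq α]
    (A : Matrix (Fin n → α) (Fin n → α) ℂ) (e : Finset (Fin n)) : Prop :=
  ∃ M : Matrix ({u // u ∈ e} → α) ({u // u ∈ e} → α) ℂ,
    ∀ x y, A x y =
      (if ∀ u ∉ e, x u = y u then (1 : ℂ) else 0) *
        M (fun u => x u.1) (fun u => y u.1)

/-- Tensor-product (product) state built from single-site matrices. -/
def prodState {n : ℕ} {α : Type*} [Fintype α] (σ : Fin n → Matrix α α ℂ) :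
    Matrix (Fin n → α) (Fin n → α) ℂ :=
  fun x y => ∏ u, σ u (x u) (y u)

/-- The Pauli matrices: `σ_0 = I`, `σ_1 = X`, `σ_2 = Y`, `σ_3 = Z`. -/
def pauli : Fin 4 → Matrix (Fin 2) (Fin 2) ℂ :=
  ![1, !![0, 1; 1, 0], !![0, -Complex.I; Complex.I, 0], !![1, 0; 0, -1]]

/-- The two-site operator `σ_i^{(u)} σ_j^{(v)}` on `n` qubits (for `u ≠ v`). -/
def pauliAt {n : ℕ} (i : Fin 4) (u : Fin n) (j : Fin 4) (v : Fin n) :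
    Matrix (Fin n → Fin 2) (Fin n → Fin 2) ℂ :=
  fun x y =>
    pauli i (x u) (y u) * pauli j (x v) (y v) *
      ∏ w : Fin n, if w = u ∨ w = v then (1 : ℂ) else if x w = y w then 1 else 0

/-- The cut-decomposed Hamiltonian
`H_D = (1/2) ∑_{i,j,k} d^{ijk} ∑_{u ≠ v, u ∈ R^{ijk}, v ∈ L^{ijk}} σ_i^{(u)} σ_j^{(v)}`. -/
def cutHam {n s : ℕ} (R L : Fin 4 → Fin 4 → Fin s → Finset (Fin n))
    (dc : Fin 4 → Fin 4 → Fin s → ℝ) : Matrix (Fin n → Fin 2) (Fin n → Fin 2) ℂ :=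
  (2 : ℂ)⁻¹ •
    ∑ i : Fin 4, ∑ j : Fin 4, ∑ k : Fin s, (dc i j k : ℂ) •
      ∑ u ∈ R i j k, ∑ v ∈ L i j k, if u = v then 0 else pauliAt i u j v

/-- The 2-local Hamiltonian `H = ∑_{u < v} H_{uv}`. -/
def twoLocalSum {n : ℕ} (Huv : Fin n → Fin n → Matrix (Fin n → Fin 2) (Fin n → Fin 2) ℂ) :
    Matrix (Fin n → Fin 2) (Fin n → Fin 2) ℂ :=
  ∑ u : Fin n, ∑ v ∈ Finset.univ.filter (fun v => u < v), Huv u v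

/-- `‖J‖_F = (∑_{u ≠ v} J_{uv}²)^{1/2}` for the interaction-strength matrix
`J_{uv} = ‖H_{uv}‖_∞`. -/
def frobJ {n : ℕ} (Huv : Fin n → Fin n → Matrix (Fin n → Fin 2) (Fin n → Fin 2) ℂ) : ℝ :=
  Real.sqrt (∑ u : Fin n, ∑ v : Fin n, if u = v then 0 else opNorm (Huv u v) ^ 2)

/-! ### Combinatorial part: Frieze-Kannan weak regularity off the diagonal -/

/-- Off-diagonal bilinear form. -/
def bil {n : ℕ} (A : Fin n → Fin n → ℝ) (a b : Fin n → ℝ) : ℝ :=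
  ∑ u, ∑ v, if u = v then 0 else A u v * a u * b v

/-- Off-diagonal squared Frobenius norm. -/
def fro {n : ℕ} (A : Fin n → Fin n → ℝ) : ℝ :=
  ∑ u, ∑ v, if u = v then 0 else A u v ^ 2

/-- Indicator of a finite set. -/
def ind {n : ℕ} (S : Finset (Fin n)) (u : Fin n) : ℝ := if u ∈ S then 1 else 0

lemma exists_subset_half {n : ℕ} (c a : Fin n → ℝ) (ha : ∀ u, |a u| ≤ 1) (t : ℝ)
    (h : t < |∑ u, c u * a u|) : ∃ S : Finset (Fin n), t / 2 < |∑ u, c u * ind S u| := by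
  by_contra hcon
  push Not at hcon
  have h1 := hcon (Finset.univ.filter fun u => 0 ≤ c u)
  have h2 := hcon (Finset.univ.filter fun u => ¬ 0 ≤ c u)
  have h3 : |∑ u, c u * a u| ≤ ∑ u, |c u| := by
    refine (Finset.abs_sum_le_sum_abs _ _).trans (Finset.sum_le_sum fun u _ => ?_)
    rw [abs_mul]
    exact mul_le_of_le_one_right (abs_nonneg _) (ha u)
  have h4 : ∑ u, |c u| = ∑ u, c u * ind (Finset.univ.filter fun u => 0 ≤ c u) u
      - ∑ u, c u * ind (Finset.univ.filter fun u => ¬ 0 ≤ c u) u := by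
    rw [← Finset.sum_sub_distrib]
    refine Finset.sum_congr rfl fun u _ => ?_
    by_cases hu : 0 ≤ c u
    · simp [ind, hu, abs_of_nonneg hu, not_lt.mpr hu]
    · have : c u < 0 := not_le.mp hu
      simp [ind, this, not_le.mpr this, abs_of_neg this]
  have h5 := le_abs_self (∑ u, c u * ind (Finset.univ.filter fun u => 0 ≤ c u) u)
  have h6 := neg_abs_le (∑ u, c u * ind (Finset.univ.filter fun u => ¬ 0 ≤ c u) u)
  linarith

lemma bil_left {n : ℕ} (A : Fin n → Fin n → ℝ) (a b : Fin n → ℝ) :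
    bil A a b = ∑ u, (∑ v, if u = v then 0 else A u v * b v) * a u := by
  unfold bil
  refine Finset.sum_congr rfl fun u _ => ?_
  rw [Finset.sum_mul]
  refine Finset.sum_congr rfl fun v _ => ?_
  split_ifs <;> ring

lemma bil_right {n : ℕ} (A : Fin n → Fin n → ℝ) (a b : Fin n → ℝ) :
    bil A a b = ∑ v, (∑ u, if u = v then 0 else A u v * a u) * b v := by
  unfold bil
  rw [Finset.sum_comm]
  refine Finset.sum_congr rfl fun u _ => ?_
  rw [Finset.sum_mul]
  refine Finset.sum_congr rfl fun v _ => ?_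
  split_ifs <;> ring

lemma exists_cut {n : ℕ} (A : Fin n → Fin n → ℝ) (a b : Fin n → ℝ) (ha : ∀ u, |a u| ≤ 1)
    (hb : ∀ u, |b u| ≤ 1) (t : ℝ) (h : t < |bil A a b|) :
    ∃ S T : Finset (Fin n), t / 4 < |bil A (ind S) (ind T)| := by
  rw [bil_left] at h
  obtain ⟨S, hS⟩ := exists_subset_half _ _ ha _ h
  rw [← bil_left, bil_right] at hS
  obtain ⟨T, hT⟩ := exists_subset_half _ _ hb _ hS
  rw [← bil_right] at hT
  exact ⟨S, T, by linarith⟩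

lemma bil_sub {n : ℕ} (A B : Fin n → Fin n → ℝ) (a b : Fin n → ℝ) :
    bil (fun u v => A u v - B u v) a b = bil A a b - bil B a b := by
  unfold bil
  simp_rw [← Finset.sum_sub_distrib]
  refine Finset.sum_congr rfl fun u _ => Finset.sum_congr rfl fun v _ => ?_
  split_ifs <;> ring

lemma fro_update {n : ℕ} (A : Fin n → Fin n → ℝ) (S T : Finset (Fin n)) (d : ℝ) :
    fro (fun u v => A u v - d * ind S u * ind T v) ≤
      fro A - 2 * d * bil A (ind S) (ind T) + d ^ 2 * (n : ℝ) ^ 2 := by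
  have : d ^ 2 * (n : ℝ) ^ 2 = ∑ _u : Fin n, ∑ _v : Fin n, d ^ 2 := by
    simp; ring
  rw [this]
  unfold fro bil
  simp_rw [Finset.mul_sum, ← Finset.sum_sub_distrib, ← Finset.sum_add_distrib]
  refine Finset.sum_le_sum fun u _ => Finset.sum_le_sum fun v _ => ?_
  have := sq_nonneg d
  unfold ind
  split_ifs <;> nlinarith

lemma weak_reg {n : ℕ} (hn : 0 < n) (θ : ℝ) (hθ : 0 ≤ θ) (N : ℕ) :
    ∀ A : Fin n → Fin n → ℝ, fro A ≤ N * θ ^ 2 →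
    ∃ (R L : Fin N → Finset (Fin n)) (d : Fin N → ℝ),
      (n : ℝ) ^ 2 * ∑ k, d k ^ 2 ≤ fro A ∧
      ∀ a b : Fin n → ℝ, (∀ u, |a u| ≤ 1) → (∀ u, |b u| ≤ 1) →
        |bil A a b - ∑ k, d k * bil (fun _ _ => 1) (fun u => ind (R k) u * a u)
          (fun u => ind (L k) u * b u)| ≤ 4 * n * θ := by
  have hn' : (0 : ℝ) < n := by exact_mod_cast hn
  have hfro : ∀ A : Fin n → Fin n → ℝ, 0 ≤ fro A := fun A =>
    Finset.sum_nonneg fun u _ => Finset.sum_nonneg fun v _ => by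
      split_ifs <;> positivity
  induction N with
  | zero =>
    intro A hA
    refine ⟨fun _ => ∅, fun _ => ∅, fun _ => 0, by simpa using hfro A, ?_⟩
    intro a b ha hb
    have h0 : fro A = 0 := le_antisymm (by simpa using hA) (hfro A)
    have h1 : ∀ u v, (if u = v then 0 else A u v ^ 2) = 0 := by
      intro u v
      have h2 := (Finset.sum_eq_zero_iff_of_nonneg (fun u _ =>
        Finset.sum_nonneg fun v _ => by split_ifs <;> positivity)).mp h0 u (Finset.mem_univ _)
      exact (Finset.sum_eq_zero_iff_of_nonneg (fun v _ => by
        split_ifs <;> positivity)).mp h2 v (Finset.mem_univ _)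
    have h3 : bil A a b = 0 := by
      refine Finset.sum_eq_zero fun u _ => Finset.sum_eq_zero fun v _ => ?_
      have := h1 u v
      split_ifs with h
      · rfl
      · rw [if_neg h] at this
        have : A u v = 0 := by simpa using this
        simp [this]
    simp only [h3]
    simp
    positivity
  | succ N ih =>
    intro A hA
    by_cases hgood : ∀ a b : Fin n → ℝ, (∀ u, |a u| ≤ 1) → (∀ u, |b u| ≤ 1) →
        |bil A a b| ≤ 4 * n * θ
    · refine ⟨fun _ => ∅, fun _ => ∅, fun _ => 0, by simpa using hfro A, ?_⟩
      intro a b ha hb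
      simpa using hgood a b ha hb
    · push Not at hgood
      obtain ⟨a, b, ha, hb, hab⟩ := hgood
      obtain ⟨S, T, hST⟩ := exists_cut A a b ha hb _ hab
      set w := bil A (ind S) (ind T) with hw
      set d0 := w / (n : ℝ) ^ 2 with hd0
      have hwd : w = d0 * (n : ℝ) ^ 2 := by rw [hd0]; field_simp
      have hup := fro_update A S T d0
      rw [← hw, hwd] at hup
      have hup' : fro (fun u v => A u v - d0 * ind S u * ind T v) ≤
          fro A - d0 ^ 2 * (n : ℝ) ^ 2 := by nlinarith
      have hbig : θ ^ 2 ≤ d0 ^ 2 * (n : ℝ) ^ 2 := by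
        have h1 : n * θ < |d0 * n ^ 2| := by rw [← hwd]; linarith
        rw [abs_mul, abs_of_pos (by positivity : (0:ℝ) < (n:ℝ)^2)] at h1
        have h2 : θ ≤ |d0| * n := by
          by_contra h
          push Not at h
          nlinarith
        calc θ ^ 2 ≤ (|d0| * n) ^ 2 := pow_le_pow_left₀ hθ h2 2
          _ = _ := by rw [mul_pow, sq_abs]
      obtain ⟨R, L, d, hd, hbd⟩ := ih (fun u v => A u v - d0 * ind S u * ind T v) (by
        push_cast at hA; linarith)
      refine ⟨Fin.cons S R, Fin.cons T L, Fin.cons d0 d, ?_, ?_⟩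
      · rw [Fin.sum_univ_succ]
        simp only [Fin.cons_zero, Fin.cons_succ]
        linarith
      · intro a b ha hb
        have := hbd a b ha hb
        rw [bil_sub] at this
        rw [Fin.sum_univ_succ]
        simp only [Fin.cons_zero, Fin.cons_succ]
        have e : bil (fun u v => d0 * ind S u * ind T v) a b =
            d0 * bil (fun _ _ => 1) (fun u => ind S u * a u) (fun u => ind T u * b u) := by
          unfold bil
          simp_rw [Finset.mul_sum]
          refine Finset.sum_congr rfl fun u _ => Finset.sum_congr rfl fun v _ => ?_
          split_ifs <;> ring
        rw [e] at this
        rwa [← sub_sub]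

/-! ### Quantum part -/

lemma trace_prod {n : ℕ} (σ ρ : Fin n → Matrix (Fin 2) (Fin 2) ℂ) :
    prodState σ * prodState ρ = prodState fun u => σ u * ρ u := by
  ext x y
  simp only [Matrix.mul_apply, prodState, ← Finset.prod_mul_distrib]
  rw [Fintype.prod_sum]

lemma trace_prodState {n : ℕ} (σ : Fin n → Matrix (Fin 2) (Fin 2) ℂ) :
    (prodState σ).trace = ∏ u, (σ u).trace := by
  simp only [Matrix.trace, Matrix.diag, prodState]
  rw [Fintype.prod_sum]

/-- Single site matrices of a two-site Pauli. -/
def pst {n : ℕ} (i : Fin 4) (u : Fin n) (j : Fin 4) (v : Fin n) (w : Fin n) :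
    Matrix (Fin 2) (Fin 2) ℂ := if w = u then pauli i else if w = v then pauli j else 1

lemma prod_two {n : ℕ} {u v : Fin n} (huv : u ≠ v) (f : Fin n → ℂ) :
    ∏ w, f w = f u * f v * ∏ w, if w = u ∨ w = v then 1 else f w := by
  have h1 : ∀ w, f w = (if w = u then f u else 1) * (if w = v then f v else 1) *
      (if w = u ∨ w = v then 1 else f w) := by
    intro w
    by_cases h : w = u
    · subst h; simp [huv]
    · by_cases h' : w = v
      · subst h'; simp [h]
      · simp [h, h']
  rw [Finset.prod_congr rfl fun w _ => h1 w, Finset.prod_mul_distrib, Finset.prod_mul_distrib]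
  simp

lemma pauliAt_eq {n : ℕ} (i j : Fin 4) {u v : Fin n} (huv : u ≠ v) :
    pauliAt i u j v = prodState (pst i u j v) := by
  ext x y
  simp only [pauliAt, prodState]
  rw [prod_two huv fun w => pst i u j v w (x w) (y w)]
  have h : pst i u j v v = pauli j := by simp [pst, huv.symm]
  rw [h]
  simp only [pst, if_true]
  congr 1
  refine Finset.prod_congr rfl fun w _ => ?_
  by_cases h : w = u
  · simp [h]
  · by_cases h' : w = v
    · simp [h']
    · simp [h, h', Matrix.one_apply]

lemma pauli_herm (i : Fin 4) : (pauli i).conjTranspose = pauli i := by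
  fin_cases i <;> ext a b <;> fin_cases a <;> fin_cases b <;>
    simp [pauli, Matrix.conjTranspose_apply]

lemma pauli_sq (i : Fin 4) : pauli i * pauli i = 1 := by
  fin_cases i <;> ext a b <;> fin_cases a <;> fin_cases b <;>
    simp [pauli, Matrix.mul_apply, Fin.sum_univ_two]

lemma pst_herm {n : ℕ} (i : Fin 4) (u : Fin n) (j : Fin 4) (v w : Fin n) :
    (pst i u j v w).conjTranspose = pst i u j v w := by
  unfold pst; split_ifs <;> simp [pauli_herm]

lemma pst_sq {n : ℕ} (i : Fin 4) (u : Fin n) (j : Fin 4) (v w : Fin n) :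
    pst i u j v w * pst i u j v w = 1 := by
  unfold pst; split_ifs <;> simp [pauli_sq]

lemma prodState_herm {n : ℕ} (σ : Fin n → Matrix (Fin 2) (Fin 2) ℂ)
    (h : ∀ w, (σ w).conjTranspose = σ w) : (prodState σ).conjTranspose = prodState σ := by
  ext x y
  simp only [Matrix.conjTranspose_apply, prodState, star_prod]
  refine Finset.prod_congr rfl fun w _ => ?_
  conv_rhs => rw [← h w]
  rfl

lemma prodState_one {n : ℕ} : prodState (fun _ : Fin n => (1 : Matrix (Fin 2) (Fin 2) ℂ)) = 1 := by
  ext x y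
  simp only [prodState, Matrix.one_apply]
  rw [Finset.prod_ite_zero]
  simp [funext_iff]

lemma opNorm_trace {n : ℕ} (A P : Matrix (Fin n → Fin 2) (Fin n → Fin 2) ℂ)
    (hP : P.conjTranspose = P) (hPP : P * P = 1) :
    ‖(A * P).trace‖ ≤ 2 ^ n * opNorm A := by
  have hPn : ‖Matrix.toEuclideanCLM (𝕜 := ℂ) P‖ ≤ 1 := by
    have h1 : star (Matrix.toEuclideanCLM (𝕜 := ℂ) P) * Matrix.toEuclideanCLM (𝕜 := ℂ) P = 1 := by
      rw [← map_star, ← map_mul, Matrix.star_eq_conjTranspose, hP, hPP, map_one]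
    have h2 := CStarRing.norm_star_mul_self (x := Matrix.toEuclideanCLM (𝕜 := ℂ) P)
    rw [h1, norm_one] at h2
    nlinarith [norm_nonneg (Matrix.toEuclideanCLM (𝕜 := ℂ) P)]
  have hent : ∀ x, ‖(A * P) x x‖ ≤ opNorm A := by
    intro x
    have h1 : (A * P) x x = (Matrix.toEuclideanCLM (𝕜 := ℂ) (A * P)
        (EuclideanSpace.single x 1)).ofLp x := by
      rw [Matrix.ofLp_toEuclideanCLM]
      simp
    rw [h1]
    refine (PiLp.norm_apply_le _ x).trans ((ContinuousLinearMap.le_opNorm _ _).trans ?_)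
    rw [PiLp.norm_single, norm_one, mul_one, map_mul]
    refine (norm_mul_le _ _).trans ?_
    exact mul_le_of_le_one_right (norm_nonneg _) hPn
  unfold Matrix.trace
  refine (norm_sum_le _ _).trans ((Finset.sum_le_sum fun x _ => hent x).trans ?_)
  simp

lemma trace_actsOn {n : ℕ} (A : Matrix (Fin n → Fin 2) (Fin n → Fin 2) ℂ)
    (e : Finset (Fin n)) (M : Matrix ({u // u ∈ e} → Fin 2) ({u // u ∈ e} → Fin 2) ℂ)
    (hM : ∀ x y, A x y = (if ∀ u ∉ e, x u = y u then (1 : ℂ) else 0) *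
        M (fun u => x u.1) (fun u => y u.1))
    (ρ : Fin n → Matrix (Fin 2) (Fin 2) ℂ) :
    (A * prodState ρ).trace = (∑ a, ∑ b, M a b * ∏ w : {u // u ∈ e}, ρ w (b w) (a w)) *
      ∏ w : {u // u ∉ e}, (ρ w).trace := by
  have key : ∀ (f : (Fin n → Fin 2) → ℂ), ∑ x, f x =
      ∑ a : {u // u ∈ e} → Fin 2, ∑ c : {u // u ∉ e} → Fin 2,
        f ((Equiv.piEquivPiSubtypeProd (fun u => u ∈ e) (fun _ => Fin 2)).symm (a, c)) := by
    intro f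
    rw [← Fintype.sum_prod_type' (fun a c =>
      f ((Equiv.piEquivPiSubtypeProd (fun u => u ∈ e) (fun _ => Fin 2)).symm (a, c)))]
    exact (Equiv.sum_comp (Equiv.piEquivPiSubtypeProd (fun u => u ∈ e) (fun _ => Fin 2)).symm f).symm
  have hterm : ∀ a c b c', 
      A ((Equiv.piEquivPiSubtypeProd (fun u => u ∈ e) (fun _ => Fin 2)).symm (a, c))
        ((Equiv.piEquivPiSubtypeProd (fun u => u ∈ e) (fun _ => Fin 2)).symm (b, c')) *
      prodState ρ ((Equiv.piEquivPiSubtypeProd (fun u => u ∈ e) (fun _ => Fin 2)).symm (b, c'))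
        ((Equiv.piEquivPiSubtypeProd (fun u => u ∈ e) (fun _ => Fin 2)).symm (a, c)) =
      if c = c' then M a b * (∏ w : {u // u ∈ e}, ρ w (b w) (a w)) *
        ∏ w : {u // u ∉ e}, ρ w (c w) (c w) else 0 := by
    intro a c b c'
    rw [hM]
    have h1 : (∀ u ∉ e, (Equiv.piEquivPiSubtypeProd (fun u => u ∈ e) (fun _ => Fin 2)).symm
        (a, c) u = (Equiv.piEquivPiSubtypeProd (fun u => u ∈ e) (fun _ => Fin 2)).symm
        (b, c') u) ↔ c = c' := by
      constructor
      · intro h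
        funext w
        have := h w.1 w.2
        simpa [Equiv.piEquivPiSubtypeProd, w.2] using this
      · rintro rfl u hu
        simp [Equiv.piEquivPiSubtypeProd, hu]
    simp only [h1]
    by_cases hc : c = c'
    · subst hc
      simp only [if_true, one_mul, prodState]
      rw [← Fintype.prod_subtype_mul_prod_subtype (fun u => u ∈ e), ← mul_assoc]
      congr 1
      · congr 1
        · congr 1 <;> funext w <;> simp [Equiv.piEquivPiSubtypeProd]
        · refine Finset.prod_congr (by ext; simp) fun w _ => ?_
          simp [Equiv.piEquivPiSubtypeProd]
      · refine Finset.prod_congr rfl fun w _ => ?_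
        simp [Equiv.piEquivPiSubtypeProd, w.2]
    · simp [hc]
  simp only [Matrix.trace, Matrix.diag, Matrix.mul_apply]
  rw [key]
  simp_rw [key, hterm]
  simp only [Finset.sum_ite_eq, Finset.mem_univ, if_true]
  rw [Fintype.prod_sum, Finset.sum_mul]
  refine Finset.sum_congr rfl fun a _ => ?_
  rw [Finset.sum_comm, Finset.sum_mul]
  refine Finset.sum_congr rfl fun b _ => ?_
  rw [Finset.mul_sum]

/-- Bloch coordinates. -/
def blo (ρ : Matrix (Fin 2) (Fin 2) ℂ) (i : Fin 4) : ℝ := ((pauli i * ρ).trace).re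

lemma density_facts (ρ : Matrix (Fin 2) (Fin 2) ℂ) (h : IsDensity ρ) :
    ∃ p x y : ℝ, ρ = !![(p : ℂ), x - y * Complex.I; x + y * Complex.I, 1 - p] ∧
      x ^ 2 + y ^ 2 ≤ p * (1 - p) := by
  obtain ⟨hp, ht⟩ := h
  have hh := hp.1
  have hd := hp.det_nonneg
  have h00 := hh.apply 0 0
  have h10 := hh.apply 0 1
  have ht' : ρ 0 0 + ρ 1 1 = 1 := by simpa [Matrix.trace, Fin.sum_univ_two] using ht
  have e00 : ((ρ 0 0).re : ℂ) = ρ 0 0 := Complex.conj_eq_iff_re.mp h00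
  have e11 : ρ 1 1 = 1 - ((ρ 0 0).re : ℂ) := by rw [e00]; linear_combination ht'
  have hmat : ρ = !![((ρ 0 0).re : ℂ), ((ρ 1 0).re : ℂ) - (ρ 1 0).im * Complex.I;
      ((ρ 1 0).re : ℂ) + (ρ 1 0).im * Complex.I, 1 - ((ρ 0 0).re : ℂ)] := by
    ext a b
    fin_cases a <;> fin_cases b
    · simp [e00]
    · simp only [Fin.zero_eta, Fin.mk_one, Matrix.of_apply, Matrix.cons_val', Matrix.cons_val_zero,
        Matrix.cons_val_one]
      rw [← h10]
      apply Complex.ext <;> simp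
    · simp
    · simp [e11]
  refine ⟨(ρ 0 0).re, (ρ 1 0).re, (ρ 1 0).im, hmat, ?_⟩
  rw [hmat, Matrix.det_fin_two_of] at hd
  have := (Complex.le_def.mp hd).1
  simp at this
  nlinarith

lemma blo_facts (ρ : Matrix (Fin 2) (Fin 2) ℂ) (h : IsDensity ρ) :
    (∀ i, (pauli i * ρ).trace = (blo ρ i : ℂ)) ∧ (∀ i, |blo ρ i| ≤ 1) ∧
    ∀ a b, ρ a b = 2⁻¹ * ∑ i, (blo ρ i : ℂ) * pauli i a b := by
  obtain ⟨p, x, y, rfl, hb⟩ := density_facts ρ h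
  have b0 : blo !![(p : ℂ), x - y * Complex.I; x + y * Complex.I, 1 - p] 0 = 1 := by
    simp [blo, pauli, Matrix.trace, Matrix.mul_apply, Fin.sum_univ_two]
  have b1 : blo !![(p : ℂ), x - y * Complex.I; x + y * Complex.I, 1 - p] 1 = 2 * x := by
    simp [blo, pauli, Matrix.trace, Matrix.mul_apply, Fin.sum_univ_two]; ring
  have b2 : blo !![(p : ℂ), x - y * Complex.I; x + y * Complex.I, 1 - p] 2 = 2 * y := by
    simp [blo, pauli, Matrix.trace, Matrix.mul_apply, Fin.sum_univ_two]; ring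
  have b3 : blo !![(p : ℂ), x - y * Complex.I; x + y * Complex.I, 1 - p] 3 = 2 * p - 1 := by
    simp [blo, pauli, Matrix.trace, Matrix.mul_apply, Fin.sum_univ_two]; ring
  refine ⟨?_, ?_, ?_⟩
  · intro i
    apply Complex.ext
    · simp [blo]
    · fin_cases i <;>
        simp [pauli, Matrix.trace, Matrix.mul_apply, Fin.sum_univ_two]
  · intro i
    have hx := sq_nonneg x
    have hy := sq_nonneg y
    have hq := sq_nonneg (2 * p - 1)
    have : ∀ i, blo !![(p : ℂ), x - y * Complex.I; x + y * Complex.I, 1 - p] i ^ 2 ≤ 1 := by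
      intro i
      fin_cases i
      · simp [b0]
      · change blo _ 1 ^ 2 ≤ 1; rw [b1]; nlinarith
      · change blo _ 2 ^ 2 ≤ 1; rw [b2]; nlinarith
      · change blo _ 3 ^ 2 ≤ 1; rw [b3]; nlinarith
    exact (sq_le_one_iff_abs_le_one _).mp (this i)
  · intro a b
    simp only [Fin.sum_univ_four, b0, b1, b2, b3]
    fin_cases a <;> fin_cases b <;> simp [pauli] <;> ring

/-- Pauli coefficient. -/
def coef {n : ℕ} (A : Matrix (Fin n → Fin 2) (Fin n → Fin 2) ℂ) (i j : Fin 4) (u v : Fin n) : ℝ :=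
  ((A * pauliAt i u j v).trace).re / 2 ^ n

lemma coef_le {n : ℕ} (A : Matrix (Fin n → Fin 2) (Fin n → Fin 2) ℂ) (i j : Fin 4) {u v : Fin n}
    (huv : u ≠ v) : |coef A i j u v| ≤ opNorm A := by
  have h := opNorm_trace A (pauliAt i u j v)
    (by rw [pauliAt_eq i j huv]; exact prodState_herm _ (pst_herm i u j v))
    (by rw [pauliAt_eq i j huv, trace_prod]; simp only [pst_sq]; exact prodState_one)
  unfold coef
  rw [abs_div, abs_of_pos (by positivity : (0 : ℝ) < 2 ^ n), div_le_iff₀ (by positivity), mul_comm]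
  exact (Complex.abs_re_le_norm _).trans h

lemma energy_pauliAt {n : ℕ} (i j : Fin 4) {u v : Fin n} (huv : u ≠ v)
    (ρ : Fin n → Matrix (Fin 2) (Fin 2) ℂ) (hρ : ∀ u, IsDensity (ρ u)) :
    energy (pauliAt i u j v) (prodState ρ) = blo (ρ u) i * blo (ρ v) j := by
  unfold energy
  rw [pauliAt_eq i j huv, trace_prod, trace_prodState, prod_two huv]
  have h1 : (∏ w, if w = u ∨ w = v then (1 : ℂ) else (pst i u j v w * ρ w).trace) = 1 := by
    refine Finset.prod_eq_one fun w _ => ?_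
    split_ifs with h
    · rfl
    · push Not at h
      simp [pst, h.1, h.2, (hρ w).2]
  rw [h1]
  have h2 : pst i u j v v = pauli j := by simp [pst, huv.symm]
  have h3 : pst i u j v u = pauli i := by simp [pst]
  rw [h2, h3, (blo_facts _ (hρ u)).1, (blo_facts _ (hρ v)).1, mul_one, ← Complex.ofReal_mul,
    Complex.ofReal_re]

lemma sum_swap3 {α β γ : Type*} [AddCommMonoid γ] [Fintype α] [Fintype β]
    (f : α → β → β → γ) : ∑ i, ∑ a, ∑ b, f i a b = ∑ a, ∑ b, ∑ i, f i a b := by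
  rw [Finset.sum_comm]
  exact Finset.sum_congr rfl fun a _ => Finset.sum_comm

lemma sum_swap {α β γ : Type*} [AddCommMonoid γ] [Fintype α] [Fintype β]
    (f : α → α → β → β → γ) :
    ∑ i, ∑ j, ∑ a, ∑ b, f i j a b = ∑ a, ∑ b, ∑ i, ∑ j, f i j a b := by
  simp_rw [sum_swap3 (f _)]
  rw [sum_swap3]

lemma energy_local {n : ℕ} (A : Matrix (Fin n → Fin 2) (Fin n → Fin 2) ℂ) {u v : Fin n}
    (huv : u ≠ v) (hA : ActsOn A {u, v})
    (ρ : Fin n → Matrix (Fin 2) (Fin 2) ℂ) (hρ : ∀ u, IsDensity (ρ u)) :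
    energy A (prodState ρ) = ∑ i, ∑ j, coef A i j u v * blo (ρ u) i * blo (ρ v) j := by
  obtain ⟨M, hM⟩ := hA
  have hpair : ∀ f : Fin n → ℂ, ∏ w : {w // w ∈ ({u, v} : Finset (Fin n))}, f w = f u * f v := by
    intro f
    rw [Finset.prod_coe_sort ({u, v} : Finset (Fin n)) f, Finset.prod_pair huv]
  have hu : u ∈ ({u, v} : Finset (Fin n)) := by simp
  have hv : v ∈ ({u, v} : Finset (Fin n)) := by simp
  have hpair' : ∀ (τ : Fin n → Matrix (Fin 2) (Fin 2) ℂ)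
      (a b : {w // w ∈ ({u, v} : Finset (Fin n))} → Fin 2),
      ∏ w : {w // w ∈ ({u, v} : Finset (Fin n))}, τ w (b w) (a w) =
        τ u (b ⟨u, hu⟩) (a ⟨u, hu⟩) * τ v (b ⟨v, hv⟩) (a ⟨v, hv⟩) := by
    intro τ a b
    have := hpair fun w => if h : w ∈ ({u, v} : Finset (Fin n)) then τ w (b ⟨w, h⟩) (a ⟨w, h⟩) else 1
    rw [dif_pos hu, dif_pos hv] at this
    rw [← this]
    refine Finset.prod_congr rfl fun w _ => ?_
    rw [dif_pos w.2]
  have hrho : ∏ w : {w // w ∉ ({u, v} : Finset (Fin n))}, (ρ w).trace = 1 :=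
    Finset.prod_eq_one fun w _ => (hρ w).2
  have hpow : (2 : ℂ) * 2 * ∏ _w : {w // w ∉ ({u, v} : Finset (Fin n))}, (2 : ℂ) = 2 ^ n := by
    rw [← hpair fun _ => 2]
    have := Fintype.prod_subtype_mul_prod_subtype
      (fun w => w ∈ ({u, v} : Finset (Fin n))) (fun _ => (2 : ℂ))
    refine Eq.trans ?_ (this.trans (by simp))
    congr!
  have htr : (A * prodState ρ).trace =
      ∑ i, ∑ j, (A * pauliAt i u j v).trace / 2 ^ n * (blo (ρ u) i * blo (ρ v) j : ℝ) := by
    have hP : ∀ i j, (A * pauliAt i u j v).trace / 2 ^ n = 4⁻¹ *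
        ∑ a, ∑ b, M a b * (pauli i (b ⟨u, hu⟩) (a ⟨u, hu⟩) * pauli j (b ⟨v, hv⟩) (a ⟨v, hv⟩)) := by
      intro i j
      rw [pauliAt_eq i j huv, trace_actsOn A _ M hM]
      have h1 : ∏ w : {w // w ∉ ({u, v} : Finset (Fin n))}, (pst i u j v w).trace =
          ∏ _w : {w // w ∉ ({u, v} : Finset (Fin n))}, (2 : ℂ) := by
        refine Finset.prod_congr rfl fun w _ => ?_
        have := w.2
        simp only [Finset.mem_insert, Finset.mem_singleton, not_or] at this
        simp [pst, this.1, this.2, Matrix.trace_one]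
      have hne : (∏ _w : {w // w ∉ ({u, v} : Finset (Fin n))}, (2 : ℂ)) ≠ 0 :=
        Finset.prod_ne_zero_iff.mpr fun _ _ => two_ne_zero
      simp_rw [hpair']
      rw [h1, ← hpow]
      have h2 : pst i u j v v = pauli j := by simp [pst, huv.symm]
      have h3 : pst i u j v u = pauli i := by simp [pst]
      rw [h2, h3]
      field_simp
      norm_num
    simp_rw [hP]
    rw [trace_actsOn A _ M hM, hrho, mul_one]
    simp_rw [hpair', (blo_facts _ (hρ u)).2.2, (blo_facts _ (hρ v)).2.2, Finset.mul_sum,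
      Finset.sum_mul, Finset.mul_sum]
    rw [sum_swap, Finset.sum_comm]
    refine Finset.sum_congr rfl fun a _ => Finset.sum_congr rfl fun b _ => Finset.sum_congr rfl fun i _ => Finset.sum_congr rfl fun j _ => ?_
    push_cast
    ring
  unfold energy
  rw [htr]
  simp only [Complex.re_sum, coef]
  refine Finset.sum_congr rfl fun i _ => Finset.sum_congr rfl fun j _ => ?_
  rw [Complex.re_mul_ofReal]
  have : ((2 : ℂ) ^ n) = ((2 ^ n : ℝ) : ℂ) := by push_cast; rfl
  rw [this, Complex.div_ofReal_re]
  ring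

lemma energy_sum {n : ℕ} {ι : Type*} (s : Finset ι)
    (A : ι → Matrix (Fin n → Fin 2) (Fin n → Fin 2) ℂ)
    (ρ : Matrix (Fin n → Fin 2) (Fin n → Fin 2) ℂ) :
    energy (∑ i ∈ s, A i) ρ = ∑ i ∈ s, energy (A i) ρ := by
  simp [energy, Finset.sum_mul, Matrix.trace_sum, Complex.re_sum]

lemma energy_smul {n : ℕ} (c : ℝ) (A ρ : Matrix (Fin n → Fin 2) (Fin n → Fin 2) ℂ) :
    energy ((c : ℂ) • A) ρ = c * energy A ρ := by
  simp [energy]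

lemma energy_twoLocal {n : ℕ} (Huv : Fin n → Fin n → Matrix (Fin n → Fin 2) (Fin n → Fin 2) ℂ)
    (hs : ∀ u v, Huv u v = Huv v u) (hA : ∀ u v, ActsOn (Huv u v) {u, v})
    (ρ : Fin n → Matrix (Fin 2) (Fin 2) ℂ) (hρ : ∀ u, IsDensity (ρ u)) :
    energy (twoLocalSum Huv) (prodState ρ) = 2⁻¹ * ∑ i, ∑ j,
      bil (fun u v => coef (Huv u v) i j u v) (fun u => blo (ρ u) i) (fun v => blo (ρ v) j) := by
  have h1 : energy (twoLocalSum Huv) (prodState ρ) =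
      ∑ u, ∑ v, if u < v then energy (Huv u v) (prodState ρ) else 0 := by
    unfold twoLocalSum
    simp only [energy_sum]
    simp only [Finset.sum_filter]
  have h2 : energy (twoLocalSum Huv) (prodState ρ) =
      ∑ u, ∑ v, if v < u then energy (Huv u v) (prodState ρ) else 0 := by
    rw [h1, Finset.sum_comm]
    refine Finset.sum_congr rfl fun u _ => Finset.sum_congr rfl fun v _ => ?_
    rw [hs v u]
  have h3 : 2 * energy (twoLocalSum Huv) (prodState ρ) =
      ∑ u, ∑ v, if u = v then 0 else energy (Huv u v) (prodState ρ) := by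
    rw [two_mul]
    nth_rewrite 1 [h1]
    rw [h2]
    simp_rw [← Finset.sum_add_distrib]
    refine Finset.sum_congr rfl fun u _ => Finset.sum_congr rfl fun v _ => ?_
    rcases lt_trichotomy u v with h | h | h
    · simp [h, h.ne, h.le]
    · simp [h]
    · simp [h, h.ne', h.le]
  have h4 : (∑ u, ∑ v, if u = v then 0 else energy (Huv u v) (prodState ρ)) = ∑ i, ∑ j,
      bil (fun u v => coef (Huv u v) i j u v) (fun u => blo (ρ u) i) (fun v => blo (ρ v) j) := by
    unfold bil
    rw [sum_swap]
    refine Finset.sum_congr rfl fun u _ => Finset.sum_congr rfl fun v _ => ?_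
    by_cases h : u = v
    · simp [h]
    · simp only [h, if_false]
      exact energy_local _ h (hA u v) ρ hρ
  rw [← h4, ← h3]
  ring

lemma energy_cutHam {n s : ℕ} (R L : Fin 4 → Fin 4 → Fin s → Finset (Fin n))
    (dc : Fin 4 → Fin 4 → Fin s → ℝ)
    (ρ : Fin n → Matrix (Fin 2) (Fin 2) ℂ) (hρ : ∀ u, IsDensity (ρ u)) :
    energy (cutHam R L dc) (prodState ρ) = 2⁻¹ * ∑ i, ∑ j, ∑ k, dc i j k *
      bil (fun _ _ => 1) (fun u => ind (R i j k) u * blo (ρ u) i)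
        (fun u => ind (L i j k) u * blo (ρ u) j) := by
  unfold cutHam
  have : (2 : ℂ)⁻¹ = ((2⁻¹ : ℝ) : ℂ) := by push_cast; rfl
  rw [this, energy_smul]
  simp only [energy_sum, energy_smul]
  congr 1
  refine Finset.sum_congr rfl fun i _ => Finset.sum_congr rfl fun j _ =>
    Finset.sum_congr rfl fun k _ => ?_
  congr 1
  unfold bil
  rw [← Finset.sum_subset (Finset.subset_univ (R i j k))]
  · refine Finset.sum_congr rfl fun u hu => ?_
    rw [← Finset.sum_subset (Finset.subset_univ (L i j k))]
    · refine Finset.sum_congr rfl fun v hv => ?_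
      by_cases h : u = v
      · simp [h, energy]
      · simp only [h, if_false]
        rw [energy_pauliAt i j h ρ hρ]
        simp [ind, hu, hv]
    · intro v _ hv
      simp [ind, hv]
  · intro u _ hu
    simp [ind, hu]

/-- weak regularity for product states.  There is a universal constant `C`
such that for every `ε ∈ (0,1)` and `n ≥ C·ε⁻²`, every 2-local Hamiltonian on `n` qubits
admits a cut decomposition of width `s ≤ C·ε⁻²` with coefficient length
`∑_k (d^{ijk})² ≤ C·‖J‖_F²/n²` whose cut-decomposed Hamiltonian `H_D` satisfies
`|Tr[Hρ] − Tr[H_D ρ]| ≤ ε·n·‖J‖_F` for every product mixed state `ρ`. -/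
theorem cut_decomposition_product_states :
    ∃ C : ℝ, 0 < C ∧
      ∀ (ε : ℝ), 0 < ε → ε < 1 →
      ∀ (n : ℕ), C / ε ^ 2 ≤ (n : ℝ) →
      ∀ Huv : Fin n → Fin n → Matrix (Fin n → Fin 2) (Fin n → Fin 2) ℂ,
        (∀ u v, Huv u v = Huv v u) →
        (∀ u, Huv u u = 0) →
        (∀ u v, (Huv u v).IsHermitian) →
        (∀ u v, ActsOn (Huv u v) {u, v}) →
        ∃ (s : ℕ) (R L : Fin 4 → Fin 4 → Fin s → Finset (Fin n))
          (dc : Fin 4 → Fin 4 → Fin s → ℝ),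
          (s : ℝ) ≤ C / ε ^ 2 ∧
          (∀ i j, ∑ k, dc i j k ^ 2 ≤ C * frobJ Huv ^ 2 / (n : ℝ) ^ 2) ∧
          ∀ ρ : Fin n → Matrix (Fin 2) (Fin 2) ℂ, (∀ u, IsDensity (ρ u)) →
            |energy (twoLocalSum Huv) (prodState ρ) -
                energy (cutHam R L dc) (prodState ρ)| ≤ ε * n * frobJ Huv := by
  refine ⟨2048, by norm_num, ?_⟩
  intro ε hε hε1 n hn Huv hsym _ _ hact
  have hn0 : (0 : ℝ) < n := lt_of_lt_of_le (by positivity) hn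
  have hn1 : 0 < n := by exact_mod_cast hn0
  have hF : 0 ≤ frobJ Huv := Real.sqrt_nonneg _
  have hF2 : frobJ Huv ^ 2 = ∑ u : Fin n, ∑ v : Fin n,
      if u = v then 0 else opNorm (Huv u v) ^ 2 := by
    unfold frobJ
    rw [Real.sq_sqrt]
    exact Finset.sum_nonneg fun u _ => Finset.sum_nonneg fun v _ => by
      split_ifs <;> positivity
  have hfro : ∀ i j, fro (fun u v => coef (Huv u v) i j u v) ≤ frobJ Huv ^ 2 := by
    intro i j
    rw [hF2]
    refine Finset.sum_le_sum fun u _ => Finset.sum_le_sum fun v _ => ?_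
    split_ifs with h
    · exact le_rfl
    · rw [← sq_abs]
      exact pow_le_pow_left₀ (abs_nonneg _) (coef_le _ i j h) 2
  have hN1 : 1024 / ε ^ 2 ≤ (⌈1024 / ε ^ 2⌉₊ : ℝ) := Nat.le_ceil _
  have hN2 : (⌈1024 / ε ^ 2⌉₊ : ℝ) ≤ 2048 / ε ^ 2 := by
    have h1 := (Nat.ceil_lt_add_one (by positivity : 0 ≤ 1024 / ε ^ 2)).le
    have h2 : 1 ≤ 1024 / ε ^ 2 := by
      rw [le_div_iff₀ (by positivity)]; nlinarith
    have h3 : 2048 / ε ^ 2 = 1024 / ε ^ 2 + 1024 / ε ^ 2 := by ring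
    linarith
  generalize ⌈1024 / ε ^ 2⌉₊ = N at hN1 hN2
  have hA : ∀ i j, fro (fun u v => coef (Huv u v) i j u v) ≤ N * (ε / 32 * frobJ Huv) ^ 2 := by
    intro i j
    refine (hfro i j).trans ?_
    rw [div_le_iff₀ (by positivity)] at hN1
    have : 0 ≤ frobJ Huv ^ 2 := by positivity
    have e : (N : ℝ) * (ε / 32 * frobJ Huv) ^ 2 = (N * ε ^ 2) / 1024 * frobJ Huv ^ 2 := by ring
    rw [e]
    exact le_mul_of_one_le_left this (by linarith)
  choose R L d hd hb using fun i j => weak_reg hn1 (ε / 32 * frobJ Huv) (by positivity) N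
    (fun u v => coef (Huv u v) i j u v) (hA i j)
  refine ⟨N, R, L, d, hN2, ?_, ?_⟩
  · intro i j
    rw [le_div_iff₀ (by positivity)]
    have := hd i j
    have := hfro i j
    nlinarith [sq_nonneg (frobJ Huv)]
  · intro ρ hρ
    rw [energy_twoLocal Huv hsym hact ρ hρ, energy_cutHam R L d ρ hρ, ← mul_sub, abs_mul]
    simp_rw [← Finset.sum_sub_distrib]
    have hle : ∀ i j, _ := fun i j => hb i j (fun u => blo (ρ u) i) (fun u => blo (ρ u) j)
      (fun u => (blo_facts _ (hρ u)).2.1 i) (fun u => (blo_facts _ (hρ u)).2.1 j)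
    have := (Finset.abs_sum_le_sum_abs _ _).trans (Finset.sum_le_sum fun i (_ : i ∈ Finset.univ) =>
      (Finset.abs_sum_le_sum_abs _ _).trans (Finset.sum_le_sum fun j (_ : j ∈ Finset.univ) =>
        hle i j))
    rw [abs_of_pos (by norm_num : (0 : ℝ) < 2⁻¹)]
    refine (mul_le_mul_of_nonneg_left this (by norm_num)).trans ?_
    simp
    apply le_of_eq
    ring

end QLH
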